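/- Let (X, f_{1,∞}) be a nonautonomous discrete dynamical system such that the sequence (f_n)_{n∈ℕ} converges uniformly to a function φ : X → X. Then φ(ω(x, f_{1,∞})) = ω(x, f_{1,∞}) for every x ∈ X. -/

import Mathlib

open Filter Topology

/-- The `n`-th iterate `f_1^n = f_n ∘ ⋯ ∘ f_1` (maps indexed from `1`; `f 0` unused). -/
def iterSeq {X : Type*} (f : ℕ → X → X) : ℕ → X → X
  | 0 => id
  | n + 1 => f (n + 1) ∘ iterSeq f n

/-- The ω-limit set of `x`: `ω(x, f_{1,∞}) = ⋂_n cl {f_1^m(x) : m ≥ n}`. -/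
def omegaSet {X : Type*} [TopologicalSpace X] (f : ℕ → X → X) (x : X) : Set X :=
  ⋂ n : ℕ, closure {y : X | ∃ m : ℕ, n ≤ m ∧ y = iterSeq f m x}

theorem mem_omegaSet_iff_mapClusterPt {X : Type*} [TopologicalSpace X] {f : ℕ → X → X} {x y : X} :
    y ∈ omegaSet f x ↔ MapClusterPt y atTop fun n => iterSeq f n x := by
  simp only [omegaSet, Set.mem_iInter, mem_closure_iff_nhds, mapClusterPt_iff_frequently,
    frequently_atTop]
  constructor
  · intro h s hs n
    obtain ⟨_, hz, m, hm, rfl⟩ := h n s hs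
    exact ⟨m, hm, hz⟩
  · intro h n s hs
    obtain ⟨m, hm, hz⟩ := h s hs n
    exact ⟨_, hz, m, hm, rfl⟩

/-- The ω-limit set does not change when the orbit is shifted by one step. -/
theorem mem_omegaSet_iff_mapClusterPt_succ {X : Type*} [TopologicalSpace X] {f : ℕ → X → X}
    {x y : X} :
    y ∈ omegaSet f x ↔ MapClusterPt y atTop fun n => f (n + 1) (iterSeq f n x) := by
  rw [mem_omegaSet_iff_mapClusterPt, MapClusterPt, MapClusterPt, ← map_add_atTop_eq_nat 1,
    map_map, map_add_atTop_eq_nat]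
  rfl

/-- Along a filter at infinity, convergence of the orbit to `z` forces its successors to converge
to `φ z`. -/
theorem tendsto_succ_of_tendstoUniformly {X : Type*} [UniformSpace X] {f : ℕ → X → X}
    {φ : X → X} (hφ : Continuous φ) (hconv : TendstoUniformly f φ atTop) {l : Filter ℕ}
    (hl : l ≤ atTop) {u : ℕ → X} {z : X} (hu : Tendsto u l (𝓝 z)) :
    Tendsto (fun n => f (n + 1) (u n)) l (𝓝 (φ z)) := by
  have h : TendstoUniformly (fun n => f (n + 1)) φ l := fun s hs =>
    ((tendsto_add_atTop_nat 1).mono_left hl).eventually (hconv s hs)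
  exact h.tendsto_comp hφ.continuousAt hu

/-- If `(f_n)` converges uniformly to `φ : X → X`, then `φ(ω(x, f_{1,∞})) = ω(x, f_{1,∞})`
for every `x ∈ X`. -/
theorem stmt11 {X : Type*} [MetricSpace X] [CompactSpace X]
    (f : ℕ → X → X) (hf : ∀ n, 1 ≤ n → Continuous (f n))
    (φ : X → X) (hconv : TendstoUniformly (fun n x => f n x) φ Filter.atTop) :
    ∀ x : X, φ '' omegaSet f x = omegaSet f x := by
  have hφ : Continuous φ :=
    hconv.continuous ((eventually_ge_atTop 1).mono hf).frequently
  intro x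
  ext y
  constructor
  · rintro ⟨z, hz, rfl⟩
    rw [mem_omegaSet_iff_mapClusterPt, mapClusterPt_iff_ultrafilter] at hz
    obtain ⟨U, hU, hz⟩ := hz
    rw [mem_omegaSet_iff_mapClusterPt_succ, mapClusterPt_iff_ultrafilter]
    exact ⟨U, hU, tendsto_succ_of_tendstoUniformly hφ hconv hU hz⟩
  · intro hy
    rw [mem_omegaSet_iff_mapClusterPt_succ, mapClusterPt_iff_ultrafilter] at hy
    obtain ⟨U, hU, hy⟩ := hy
    have hz := (U.map fun n => iterSeq f n x).le_nhds_lim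
    refine ⟨_, ?_, tendsto_nhds_unique
      (tendsto_succ_of_tendstoUniformly hφ hconv hU hz) hy⟩
    rw [mem_omegaSet_iff_mapClusterPt, mapClusterPt_iff_ultrafilter]
    exact ⟨U, hU, hz⟩
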